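/- Let Λ be a finite-dimensional algebra over an algebraically closed field K such that Λ has finite self-injective dimension as a right Λ-module (inj.dim Λ_Λ < ∞). Then the singularity category D_sg(Λ) admits no non-zero silting object. -/

import Mathlib

/- Formalization of statements from
   "Report on the finiteness of silting objects"
   by T. Aihara, T. Honma, K. Miyamoto, Q. Wang. -/

open CategoryTheory CategoryTheory.Limits

universe u v w

noncomputable section
namespace PaperSilting
/-! ### Silting theory in triangulated categories. -/

open Pretriangulated

section Triangulated

variable {C : Type u} [Category.{v} C] [Preadditive C] [HasZeroObject C] [HasShift C ℤ]
  [∀ n : ℤ, (shiftFunctor C n).Additive] [Pretriangulated C]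

/-- A class of objects of a triangulated category is thick: it is closed under
isomorphisms, shifts, cones and direct summands (retracts). -/
structure IsThickClass (P : C → Prop) : Prop where
  iso : ∀ {X Y : C}, (X ≅ Y) → P X → P Y
  shift : ∀ (X : C) (n : ℤ), P X → P (X⟦n⟧)
  cone : ∀ T ∈ distTriang C, P T.obj₁ → P T.obj₂ → P T.obj₃
  retract : ∀ (X Y : C) (i : X ⟶ Y) (r : Y ⟶ X), i ≫ r = 𝟙 X → P Y → P X

/-- `X` belongs to the smallest thick subcategory containing `S`. -/
def InThick (S : Set C) (X : C) : Prop :=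
  ∀ P : C → Prop, IsThickClass P → (∀ Y ∈ S, P Y) → P X

/-- A presilting object: `Hom(M, M[n]) = 0` for all `n > 0`. -/
def IsPresiltingObj (M : C) : Prop := ∀ n : ℤ, 0 < n → ∀ f : M ⟶ M⟦n⟧, f = 0

/-- A pretilting object: `Hom(M, M[n]) = 0` for all `n ≠ 0`. -/
def IsPretiltingObj (M : C) : Prop := ∀ n : ℤ, n ≠ 0 → ∀ f : M ⟶ M⟦n⟧, f = 0

/-- A silting object of the triangulated category `C`. -/
def IsSiltingObj (M : C) : Prop := IsPresiltingObj M ∧ ∀ X : C, InThick {M} X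

/-- A silting object of the thick subcategory of `C` determined by the class `S`. -/
def IsSiltingFor (S : C → Prop) (M : C) : Prop :=
  S M ∧ IsPresiltingObj M ∧ ∀ X : C, S X → InThick {M} X

/-- A tilting object of the thick subcategory of `C` determined by the class `S`. -/
def IsTiltingFor (S : C → Prop) (M : C) : Prop :=
  S M ∧ IsPretiltingObj M ∧ ∀ X : C, S X → InThick {M} X

/-- A basic object: it has no direct summand of the form `Y ⊕ Y` with `Y ≠ 0`. -/
def IsBasicObj (M : C) : Prop :=
  ∀ (Y : C) (i₁ i₂ : Y ⟶ M) (p₁ p₂ : M ⟶ Y),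
    i₁ ≫ p₁ = 𝟙 Y → i₂ ≫ p₂ = 𝟙 Y → i₁ ≫ p₂ = 0 → i₂ ≫ p₁ = 0 → IsZero Y

end Triangulated

/-! ### The homotopy category of complexes of modules; perfect complexes. -/

/-- The homotopy category of (unbounded) cochain complexes of `R`-modules.
Its full subcategory of bounded complexes of finitely generated projectives is
`K^b(proj R)`, and its full subcategory of right-bounded complexes of finitely
generated projectives with bounded cohomology is a model for `D^b(mod R)`. -/
abbrev HtpyCat (R : Type) [Ring R] :=
  HomotopyCategory (ModuleCat.{0} R) (ComplexShape.up ℤ)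

/-- The object of the homotopy category attached to a complex. -/
def ofComplex (R : Type) [Ring R] (P : CochainComplex (ModuleCat.{0} R) ℤ) : HtpyCat R :=
  (HomotopyCategory.quotient _ _).obj P

/-- A perfect object: isomorphic to a bounded complex of finitely generated
projective modules.  These are the objects of `K^b(proj R)`. -/
def IsPerfObj (R : Type) [Ring R] (X : HtpyCat R) : Prop :=
  ∃ P : CochainComplex (ModuleCat.{0} R) ℤ,
    (∀ i, Projective (P.X i) ∧ Module.Finite R (P.X i)) ∧
    (∃ a b : ℤ, ∀ i, i < a ∨ b < i → IsZero (P.X i)) ∧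
    Nonempty (X ≅ ofComplex R P)

/-- An object of (the standard model `K^{-,b}(proj R)` of) the bounded derived
category `D^b(mod R)`: isomorphic to a right-bounded complex of finitely
generated projective modules with bounded cohomology. -/
def IsDbObj (R : Type) [Ring R] (X : HtpyCat R) : Prop :=
  ∃ P : CochainComplex (ModuleCat.{0} R) ℤ,
    (∀ i, Projective (P.X i) ∧ Module.Finite R (P.X i)) ∧
    (∃ b : ℤ, ∀ i, b < i → IsZero (P.X i)) ∧
    (∃ a : ℤ, ∀ i, i < a → P.ExactAt i) ∧
    Nonempty (X ≅ ofComplex R P)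

/-- An object of the homotopy category presented by a complex of finitely
generated projectives concentrated in the `m` degrees `-m < i ≤ 0`. -/
def IsMTermObj (R : Type) [Ring R] (m : ℕ) (X : HtpyCat R) : Prop :=
  ∃ P : CochainComplex (ModuleCat.{0} R) ℤ,
    (∀ i, Projective (P.X i) ∧ Module.Finite R (P.X i)) ∧
    (∀ i : ℤ, 0 < i ∨ i ≤ -(m : ℤ) → IsZero (P.X i)) ∧
    Nonempty (X ≅ ofComplex R P)

/-- The stalk complex of the regular module `R`, placed in degree `0`. -/
def stalkRing (R : Type) [Ring R] : HtpyCat R :=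
  ofComplex R
    ((HomologicalComplex.single (ModuleCat.{0} R) (ComplexShape.up ℤ) 0).obj (ModuleCat.of R R))

/-- The regular module `R` has finite injective dimension: it admits a finite
injective coresolution. -/
def HasFiniteSelfInjDim (R : Type) [Ring R] : Prop :=
  ∃ (n : ℕ) (I : CochainComplex (ModuleCat.{0} R) ℤ)
    (φ : (HomologicalComplex.single (ModuleCat.{0} R) (ComplexShape.up ℤ) 0).obj
          (ModuleCat.of R R) ⟶ I),
    (∀ i, Injective (I.X i)) ∧ (∀ i : ℤ, i < 0 ∨ (n : ℤ) < i → IsZero (I.X i)) ∧ QuasiIso φ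

/-- For a selfinjective (more generally Iwanaga–Gorenstein) ring, the stable
category of Cohen–Macaulay modules is modelled by acyclic (equivalently,
totally acyclic) complexes of finitely generated projectives (Buchweitz). -/
def IsCMStableObj (R : Type) [Ring R] (X : HtpyCat R) : Prop :=
  ∃ P : CochainComplex (ModuleCat.{0} R) ℤ,
    (∀ i, Projective (P.X i) ∧ Module.Finite R (P.X i)) ∧
    (∀ i, P.ExactAt i) ∧ Nonempty (X ≅ ofComplex R P)

/-- `R` is tilting-discrete: for every `m > 0` there are only finitely many
basic `m`-term tilting objects in `K^b(proj R)` up to isomorphism. -/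
def IsTiltingDiscreteRing (R : Type) [Ring R] : Prop :=
  ∀ m : ℕ, 0 < m → ∃ (k : ℕ) (f : Fin k → HtpyCat R),
    ∀ X : HtpyCat R, IsTiltingFor (IsPerfObj R) X → IsMTermObj R m X → IsBasicObj X →
      ∃ i, Nonempty (X ≅ f i)

/-- A (selfinjective) algebra `Λ` is tilting-discrete (with respect to right modules). -/
def IsTiltingDiscrete (Λ : Type) [Ring Λ] : Prop := IsTiltingDiscreteRing Λᵐᵒᵖ
/-! ### The singularity category as a Verdier quotient.

`D_sg(R)` is the Verdier quotient of `D^b(mod R)` by the perfect complexes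
`K^b(proj R)`.  We work with the model of `D^b(mod R)` given by the full
subcategory of the homotopy category on the objects `IsDbObj`, and we
specify a model of the quotient by the data of a localization functor `Q` which is
essentially surjective, commutes with shifts, sends distinguished triangles to
distinguished triangles, inverts precisely the morphisms whose cone is perfect,
and is universal among such functors. -/

/-- The morphism `f : X → Y` in `D^b(mod R)` has a cone lying in `K^b(proj R)`. -/
def HasPerfectCone (R : Type) [Ring R] {X Y : HtpyCat R} (f : X ⟶ Y) : Prop :=
  ∃ (Z : HtpyCat R) (g : Y ⟶ Z) (h : Z ⟶ X⟦(1 : ℤ)⟧), IsPerfObj R Z ∧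
    Pretriangulated.Triangle.mk f g h ∈ distTriang (HtpyCat R)

/-- The data of a model of the singularity category `D_sg(R)`. -/
structure SgModelData (R : Type) [Ring R] (C : Type u) [Category.{v} C] [Preadditive C]
    [HasZeroObject C] [HasShift C ℤ] [∀ n : ℤ, (shiftFunctor C n).Additive]
    [Pretriangulated C] where
  /-- the canonical quotient functor -/
  Q : ObjectProperty.FullSubcategory (IsDbObj R) ⥤ C
  essSurj : ∀ Z : C, ∃ X : ObjectProperty.FullSubcategory (IsDbObj R), Nonempty (Q.obj X ≅ Z)
  commShift : ∀ (X : ObjectProperty.FullSubcategory (IsDbObj R)) (n : ℤ) (h : IsDbObj R (X.obj⟦n⟧)),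
    Nonempty (Q.obj ⟨X.obj⟦n⟧, h⟩ ≅ (Q.obj X)⟦n⟧)
  mapsTriangles : ∀ (X Y Z : ObjectProperty.FullSubcategory (IsDbObj R)) (f : X.obj ⟶ Y.obj)
    (g : Y.obj ⟶ Z.obj) (h : Z.obj ⟶ X.obj⟦(1 : ℤ)⟧),
    (Pretriangulated.Triangle.mk f g h ∈ distTriang (HtpyCat R)) →
    ∃ h' : Q.obj Z ⟶ (Q.obj X)⟦(1 : ℤ)⟧,
      Pretriangulated.Triangle.mk (Q.map (X := X) (Y := Y) (ObjectProperty.homMk f)) (Q.map (X := Y) (Y := Z) (ObjectProperty.homMk g)) h'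
        ∈ distTriang C
  invertsIff : ∀ (X Y : ObjectProperty.FullSubcategory (IsDbObj R)) (f : X.obj ⟶ Y.obj),
    IsIso (Q.map (X := X) (Y := Y) (ObjectProperty.homMk f)) ↔ HasPerfectCone R f
  universal : ∀ (E : Type w) [Category.{v} E] (F : ObjectProperty.FullSubcategory (IsDbObj R) ⥤ E),
    (∀ (X Y : ObjectProperty.FullSubcategory (IsDbObj R)) (f : X.obj ⟶ Y.obj),
      HasPerfectCone R f → IsIso (F.map (X := X) (Y := Y) (ObjectProperty.homMk f))) →
    ∃ G : C ⥤ E, Nonempty (Q ⋙ G ≅ F)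

/-! ### Vanishing of morphisms into shifts. -/

section Vanishing

variable {C : Type u} [Category.{v} C] [Preadditive C] [HasShift C ℤ]

/-- Every morphism from `A` to the shift `B⟦n⟧` is zero. -/
def HomShiftVanishes (A B : C) (n : ℤ) : Prop := ∀ f : A ⟶ B⟦n⟧, f = 0

namespace HomShiftVanishes

variable {A A' B B' : C} {n : ℤ}

lemma retract_right (h : HomShiftVanishes A B n) (i : B' ⟶ B) (r : B ⟶ B') (hir : i ≫ r = 𝟙 B') :
    HomShiftVanishes A B' n := fun f => by
  have : f = (f ≫ i⟦n⟧') ≫ r⟦n⟧' := by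
    rw [Category.assoc, ← Functor.map_comp, hir, CategoryTheory.Functor.map_id, Category.comp_id]
  rw [this, h (f ≫ i⟦n⟧'), zero_comp]

lemma retract_left (h : HomShiftVanishes A B n) (i : A' ⟶ A) (r : A ⟶ A') (hir : i ≫ r = 𝟙 A') :
    HomShiftVanishes A' B n := fun f => by
  have : f = i ≫ r ≫ f := by rw [← Category.assoc, hir, Category.id_comp]
  rw [this, h (r ≫ f), comp_zero]

lemma iso_right (h : HomShiftVanishes A B n) (e : B ≅ B') : HomShiftVanishes A B' n :=
  h.retract_right e.inv e.hom e.inv_hom_id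

lemma iso_left (h : HomShiftVanishes A B n) (e : A ≅ A') : HomShiftVanishes A' B n :=
  h.retract_left e.inv e.hom e.inv_hom_id

lemma shift_right (m : ℤ) (h : HomShiftVanishes A B (m + n)) : HomShiftVanishes A (B⟦m⟧) n :=
  fun f => by
    rw [← cancel_mono ((shiftFunctorAdd C m n).inv.app B), zero_comp]
    exact h _

variable [∀ n : ℤ, (shiftFunctor C n).Additive]

lemma shift_left (m : ℤ) (h : HomShiftVanishes A B (n - m)) : HomShiftVanishes (A⟦m⟧) B n :=
  fun f => by
    obtain ⟨g, hg⟩ := (shiftFunctor C m).map_surjective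
      (f ≫ (shiftFunctorAdd' C (n - m) m n (by lia)).hom.app B)
    rw [← cancel_mono ((shiftFunctorAdd' C (n - m) m n (by lia)).hom.app B), zero_comp, ← hg,
      h g, Functor.map_zero]

variable [HasZeroObject C] [Pretriangulated C]

lemma of_distTriang_right {T : Triangle C} (hT : T ∈ distTriang C)
    (h₁ : HomShiftVanishes A T.obj₁ n) (h₃ : HomShiftVanishes A T.obj₃ n) :
    HomShiftVanishes A T.obj₂ n := fun f => by
  obtain ⟨g, hg⟩ := Triangle.coyoneda_exact₂ _ (Triangle.shift_distinguished T hT n) f (h₃ _)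
  obtain rfl : g = 0 := h₁ g
  exact hg.trans zero_comp

lemma of_distTriang_left {T : Triangle C} (hT : T ∈ distTriang C)
    (h₁ : HomShiftVanishes T.obj₁ B n) (h₃ : HomShiftVanishes T.obj₃ B n) :
    HomShiftVanishes T.obj₂ B n := fun f => by
  obtain ⟨g, hg⟩ := Triangle.yoneda_exact₂ _ hT f (h₁ _)
  rw [hg, h₃ g, comp_zero]

end HomShiftVanishes

variable [HasZeroObject C] [∀ n : ℤ, (shiftFunctor C n).Additive] [Pretriangulated C]

variable (C) in
lemma isThickClass_eventually_homShiftVanishes_right (A : C) :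
    IsThickClass fun B : C => ∃ N : ℤ, ∀ n ≥ N, HomShiftVanishes A B n where
  iso e := fun ⟨N, h⟩ => ⟨N, fun n hn => (h n hn).iso_right e⟩
  shift B m := fun ⟨N, h⟩ => ⟨N - m, fun n hn => .shift_right m (h _ (by lia))⟩
  cone T hT := fun ⟨N₁, h₁⟩ ⟨N₂, h₂⟩ => ⟨max N₁ N₂, fun n hn =>
    .of_distTriang_right (rot_of_distTriang _ hT) (h₂ n (by lia))
      (.shift_right 1 (h₁ _ (by lia)))⟩
  retract X Y i r hir := fun ⟨N, h⟩ => ⟨N, fun n hn => (h n hn).retract_right i r hir⟩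

variable (C) in
lemma isThickClass_eventually_homShiftVanishes_left (B : C) :
    IsThickClass fun A : C => ∃ N : ℤ, ∀ n ≥ N, HomShiftVanishes A B n where
  iso e := fun ⟨N, h⟩ => ⟨N, fun n hn => (h n hn).iso_left e⟩
  shift A m := fun ⟨N, h⟩ => ⟨N + m, fun n hn => .shift_left m (h _ (by lia))⟩
  cone T hT := fun ⟨N₁, h₁⟩ ⟨N₂, h₂⟩ => ⟨max (N₁ + 1) N₂, fun n hn =>
    .of_distTriang_left (rot_of_distTriang _ hT) (h₂ n (by lia))
      (.shift_left 1 (h₁ _ (by lia)))⟩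
  retract X Y i r hir := fun ⟨N, h⟩ => ⟨N, fun n hn => (h n hn).retract_left i r hir⟩

lemma IsSiltingObj.eventually_homShiftVanishes {M : C} (hM : IsSiltingObj M) (A B : C) :
    ∃ N : ℤ, ∀ n ≥ N, HomShiftVanishes A B n := by
  refine hM.2 A _ (isThickClass_eventually_homShiftVanishes_left C B) ?_
  rintro _ rfl
  refine hM.2 B _ (isThickClass_eventually_homShiftVanishes_right C _) ?_
  rintro _ rfl
  exact ⟨1, fun n hn => hM.1 n (by lia)⟩

end Vanishing

/-! ### The comparison with the derived category. -/

section Derived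

attribute [local instance] HasDerivedCategory.standard

variable {R : Type} [Ring R]

open DerivedCategory

lemma IsDbObj.of_iso {X Y : HtpyCat R} (hX : IsDbObj R X) (e : Y ≅ X) : IsDbObj R Y := by
  obtain ⟨P, h₁, h₂, h₃, ⟨e'⟩⟩ := hX
  exact ⟨P, h₁, h₂, h₃, ⟨e ≪≫ e'⟩⟩

lemma IsDbObj.leftOrthogonal {X : HtpyCat R} (hX : IsDbObj R X) :
    (HomotopyCategory.subcategoryAcyclic (ModuleCat.{0} R)).leftOrthogonal X := by
  obtain ⟨P, hP, ⟨b, hb⟩, -, ⟨e⟩⟩ := hX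
  have := fun i => (hP i).1
  have : P.IsStrictlyLE b := (P.isStrictlyLE_iff b).2 hb
  have := CochainComplex.isKProjective_of_projective P b
  exact ObjectProperty.prop_of_iso _ e.symm (CochainComplex.IsKProjective.leftOrthogonal P)

lemma Qh_map_bijective_of_leftOrthogonal {X : HtpyCat R}
    (hX : (HomotopyCategory.subcategoryAcyclic (ModuleCat.{0} R)).leftOrthogonal X)
    (Y : HtpyCat R) :
    Function.Bijective (Qh.map : (X ⟶ Y) → (Qh.obj X ⟶ Qh.obj Y)) :=
  hX.map_bijective_of_isTriangulated _ _

lemma exists_iso_of_Qh_iso {X Y : HtpyCat R}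
    (hX : (HomotopyCategory.subcategoryAcyclic (ModuleCat.{0} R)).leftOrthogonal X)
    (hY : (HomotopyCategory.subcategoryAcyclic (ModuleCat.{0} R)).leftOrthogonal Y)
    (e : Qh.obj X ≅ Qh.obj Y) : ∃ e' : X ≅ Y, Qh.map e'.hom = e.hom := by
  obtain ⟨f, hf⟩ := (Qh_map_bijective_of_leftOrthogonal hX Y).2 e.hom
  obtain ⟨g, hg⟩ := (Qh_map_bijective_of_leftOrthogonal hY X).2 e.inv
  exact ⟨⟨f, g, (Qh_map_bijective_of_leftOrthogonal hX X).1 (by simp [hf, hg]),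
    (Qh_map_bijective_of_leftOrthogonal hY Y).1 (by simp [hf, hg])⟩, hf⟩

/-- The object `Y` of the homotopy category is a resolution of the module `Z` by finitely
generated projective modules. -/
structure IsResolution (Y : HtpyCat R) (Z : ModuleCat.{0} R) : Prop where
  isDbObj : IsDbObj R Y
  nonempty_iso : Nonempty (Qh.obj Y ≅ (singleFunctor (ModuleCat.{0} R) 0).obj Z)

/-- Resolutions of the terms of a short exact sequence fit into a distinguished triangle. -/
lemma exists_distTriang_of_shortExact {S : ShortComplex (ModuleCat.{0} R)} (hS : S.ShortExact)
    {Y₁ Y₂ Y₃ : HtpyCat R} (h₁ : IsResolution Y₁ S.X₁) (h₂ : IsResolution Y₂ S.X₂)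
    (h₃ : IsResolution Y₃ S.X₃) :
    ∃ (f : Y₁ ⟶ Y₂) (g : Y₂ ⟶ Y₃) (h : Y₃ ⟶ Y₁⟦(1 : ℤ)⟧),
      Triangle.mk f g h ∈ distTriang (HtpyCat R) := by
  obtain ⟨e₁⟩ := h₁.nonempty_iso
  obtain ⟨e₂⟩ := h₂.nonempty_iso
  obtain ⟨e₃⟩ := h₃.nonempty_iso
  obtain ⟨f, hf⟩ := (Qh_map_bijective_of_leftOrthogonal h₁.isDbObj.leftOrthogonal Y₂).2
    (e₁.hom ≫ (singleFunctor (ModuleCat.{0} R) 0).map S.f ≫ e₂.inv)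
  obtain ⟨W, g, h, hT⟩ := distinguished_cocone_triangle f
  have hW : (HomotopyCategory.subcategoryAcyclic (ModuleCat.{0} R)).leftOrthogonal W :=
    ObjectProperty.ext_of_isTriangulatedClosed₃ _ _ hT h₁.isDbObj.leftOrthogonal
      h₂.isDbObj.leftOrthogonal
  let e : Qh.mapTriangle.obj (Triangle.mk f g h) ≅ hS.singleTriangle :=
    isoTriangleOfIso₁₂ _ _ (Qh.map_distinguished _ hT) hS.singleTriangle_distinguished e₁ e₂
      (by
        change Qh.map f ≫ e₂.hom = e₁.hom ≫ (singleFunctor (ModuleCat.{0} R) 0).map S.f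
        simp [hf])
  obtain ⟨w, -⟩ := exists_iso_of_Qh_iso hW h₃.isDbObj.leftOrthogonal
    (Triangle.π₃.mapIso e ≪≫ e₃.symm)
  exact ⟨f, g ≫ w.hom, w.inv ≫ h, isomorphic_distinguished _ hT _
    (Triangle.isoMk _ _ (Iso.refl _) (Iso.refl _) w.symm
      ((Category.comp_id _).trans (Category.id_comp _).symm)
      (by
        change (g ≫ w.hom) ≫ w.inv = 𝟙 _ ≫ g
        simp)
      (by
        change (w.inv ≫ h) ≫ (𝟙 Y₁)⟦(1 : ℤ)⟧' = w.inv ≫ h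
        simp))⟩

lemma exists_retract_of_retract {Z Z' : ModuleCat.{0} R} (i : Z' ⟶ Z) (r : Z ⟶ Z')
    (hir : i ≫ r = 𝟙 Z') {Y Y' : HtpyCat R} (hY : IsResolution Y Z) (hY' : IsResolution Y' Z') :
    ∃ (i' : Y' ⟶ Y) (r' : Y ⟶ Y'), i' ≫ r' = 𝟙 Y' := by
  obtain ⟨e⟩ := hY.nonempty_iso
  obtain ⟨e'⟩ := hY'.nonempty_iso
  obtain ⟨f, hf⟩ := (Qh_map_bijective_of_leftOrthogonal hY'.isDbObj.leftOrthogonal Y).2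
    (e'.hom ≫ (singleFunctor (ModuleCat.{0} R) 0).map i ≫ e.inv)
  obtain ⟨g, hg⟩ := (Qh_map_bijective_of_leftOrthogonal hY.isDbObj.leftOrthogonal Y').2
    (e.hom ≫ (singleFunctor (ModuleCat.{0} R) 0).map r ≫ e'.inv)
  refine ⟨f, g, (Qh_map_bijective_of_leftOrthogonal hY'.isDbObj.leftOrthogonal Y').1 ?_⟩
  rw [Functor.map_comp, hf, hg]
  simp [← Functor.map_comp_assoc, hir]

end Derived

/-! ### Existence of resolutions over Noetherian rings. -/

section Resolutions

variable {R : Type} [Ring R]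

instance projective_fgModuleCat_of (n : ℕ) :
    Projective (FGModuleCat.of R (Fin n → R)) where
  factors {E X} f e he := by
    have he' : Function.Surjective e.hom.hom :=
      (ModuleCat.epi_iff_surjective _).1
        (inferInstanceAs (Epi ((forget₂ (FGModuleCat.{0} R) (ModuleCat.{0} R)).map e)))
    obtain ⟨g, hg⟩ := Module.projective_lifting_property e.hom.hom f.hom.hom he'
    exact ⟨FGModuleCat.ofHom g, ObjectProperty.hom_ext _ (ModuleCat.hom_ext hg)⟩

lemma exists_epi_fgModuleCat_of (M : FGModuleCat.{0} R) :
    ∃ (n : ℕ) (f : FGModuleCat.of R (Fin n → R) ⟶ M), Epi f := by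
  obtain ⟨n, f, hf⟩ := Module.Finite.exists_fin' R M
  refine ⟨n, FGModuleCat.ofHom f, ?_⟩
  have : Epi ((forget₂ (FGModuleCat.{0} R) (ModuleCat.{0} R)).map (FGModuleCat.ofHom f)) :=
    (ModuleCat.epi_iff_surjective _).2 hf
  exact (forget₂ (FGModuleCat.{0} R) (ModuleCat.{0} R)).epi_of_epi_map this

instance enoughProjectives_fgModuleCat : EnoughProjectives (FGModuleCat.{0} R) where
  presentation M := by
    obtain ⟨n, f, hf⟩ := exists_epi_fgModuleCat_of M
    exact ⟨{ p := FGModuleCat.of R (Fin n → R), f := f }⟩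

instance additive_forget₂_fgModuleCat :
    (forget₂ (FGModuleCat.{0} R) (ModuleCat.{0} R)).Additive where
  map_add := rfl

instance preservesProjectiveObjects_forget₂_fgModuleCat :
    (forget₂ (FGModuleCat.{0} R) (ModuleCat.{0} R)).PreservesProjectiveObjects where
  projective_obj {P} hP := by
    obtain ⟨n, f, hf⟩ := exists_epi_fgModuleCat_of P
    have : Projective ((forget₂ (FGModuleCat.{0} R) (ModuleCat.{0} R)).obj
        (FGModuleCat.of R (Fin n → R))) :=
      ModuleCat.projective_of_free (M := ModuleCat.of R (Fin n → R)) (Pi.basisFun R (Fin n))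
    exact ((Retract.mk (Projective.factorThru (𝟙 P) f) f (by simp)).map
      (forget₂ (FGModuleCat.{0} R) (ModuleCat.{0} R))).projective

attribute [local instance] HasDerivedCategory.standard

lemma exists_isResolution [IsNoetherianRing R] (Z : ModuleCat.{0} R) [Module.Finite R Z] :
    ∃ Y : HtpyCat R, IsResolution Y Z := by
  let P := (forget₂ (FGModuleCat.{0} R) (ModuleCat.{0} R)).mapProjectiveResolution
    (projectiveResolution (FGModuleCat.of R Z))
  have hP : ∀ i, Module.Finite R (P.cochainComplex.X i) := by
    intro i
    by_cases hi : i ≤ 0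
    · obtain ⟨n, hn⟩ := Int.eq_ofNat_of_zero_le (Int.neg_nonneg.2 hi)
      have : Module.Finite R (P.complex.X n) :=
        ((projectiveResolution (FGModuleCat.of R Z)).complex.X n).property
      exact Module.Finite.equiv
        (P.cochainComplexXIso i n (by lia)).symm.toLinearEquiv
    · have : Subsingleton (P.cochainComplex.X i) := ModuleCat.subsingleton_of_isZero
        (P.cochainComplex.isZero_of_isStrictlyLE 0 i (by lia))
      infer_instance
  refine ⟨ofComplex R P.cochainComplex, ⟨P.cochainComplex, fun i => ⟨inferInstance, hP i⟩,
    ⟨0, fun i hi => P.cochainComplex.isZero_of_isStrictlyLE 0 i hi⟩,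
    ⟨0, fun i hi => P.cochainComplex.exactAt_of_isGE 0 i hi⟩, ⟨Iso.refl _⟩⟩, ⟨?_⟩⟩
  exact (DerivedCategory.quotientCompQhIso (ModuleCat.{0} R)).app _ ≪≫
    asIso (DerivedCategory.Q.map P.π') ≪≫
      ((DerivedCategory.singleFunctorIsoCompQ (ModuleCat.{0} R) 0).app _).symm

end Resolutions

/-! ### Brutal truncations. -/

section Truncation

variable {R : Type} [Ring R]

/-- The quotient of a complex of modules by a family of submodules stable under the
differentials. -/
@[simps]
def quotientComplex (P : CochainComplex (ModuleCat.{0} R) ℤ) (N : ∀ i, Submodule R (P.X i))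
    (hN : ∀ i j, N i ≤ (N j).comap (P.d i j).hom) : CochainComplex (ModuleCat.{0} R) ℤ where
  X i := ModuleCat.of R (P.X i ⧸ N i)
  d i j := ModuleCat.ofHom (Submodule.mapQ _ _ (P.d i j).hom (hN i j))
  shape i j hij := by
    ext x
    simp [P.shape i j hij]
  d_comp_d' i j k _ _ := by
    ext x
    have h : (P.d j k).hom ((P.d i j).hom x) = 0 :=
      ConcreteCategory.congr_hom (P.d_comp_d i j k) x
    simp [h]

/-- The projection onto the quotient of a complex by a family of submodules. -/
@[simps]
def toQuotientComplex (P : CochainComplex (ModuleCat.{0} R) ℤ) (N : ∀ i, Submodule R (P.X i))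
    (hN : ∀ i j, N i ≤ (N j).comap (P.d i j).hom) : P ⟶ quotientComplex P N hN where
  f i := ModuleCat.ofHom (N i).mkQ

/-- A complex has, for every `m`, a quotient which agrees with it in degrees at most `m` and which
vanishes in the other degrees. -/
lemma exists_brutalTruncation (P : CochainComplex (ModuleCat.{0} R) ℤ) (m : ℤ) :
    ∃ (P' : CochainComplex (ModuleCat.{0} R) ℤ) (π : P ⟶ P'), (∀ i, m < i → IsZero (P'.X i)) ∧
      (∀ i, Epi (π.f i)) ∧ ∀ i, i ≤ m → IsIso (π.f i) := by
  let N (i : ℤ) : Submodule R (P.X i) := if i ≤ m then ⊥ else ⊤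
  have hN : ∀ i j, N i ≤ (N j).comap (P.d i j).hom := by
    intro i j
    by_cases hij : i + 1 = j
    · by_cases hi : i ≤ m
      · simp [N, hi]
      · simp [N, show ¬ j ≤ m by lia]
    · intro x _
      simp [P.shape i j hij]
  have hepi : ∀ i, Epi ((toQuotientComplex P N hN).f i) := fun i =>
    (ModuleCat.epi_iff_surjective _).2 (N i).mkQ_surjective
  refine ⟨quotientComplex P N hN, toQuotientComplex P N hN, fun i hi => ?_, hepi, fun i hi => ?_⟩
  · have : Subsingleton ((quotientComplex P N hN).X i) :=
      Submodule.Quotient.subsingleton_iff.2 (if_neg (by lia))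
    exact ModuleCat.isZero_of_subsingleton _
  · have := hepi i
    have : Mono ((toQuotientComplex P N hN).f i) := by
      refine (ModuleCat.mono_iff_injective _).2 (LinearMap.ker_eq_bot.1 ?_)
      exact (Submodule.ker_mkQ (N i)).trans (if_pos hi)
    exact isIso_of_mono_of_epi _

lemma isPerfObj_shift {X : HtpyCat R} (hX : IsPerfObj R X) (n : ℤ) : IsPerfObj R (X⟦n⟧) := by
  obtain ⟨P, hP, ⟨a, b, hab⟩, ⟨e⟩⟩ := hX
  exact ⟨P⟦n⟧, fun i => hP (i + n), ⟨a - n, b - n, fun i hi => hab (i + n) (by lia)⟩,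
    ⟨(shiftFunctor _ n).mapIso e ≪≫
      (((HomotopyCategory.quotient _ (ComplexShape.up ℤ)).commShiftIso n).app P).symm⟩⟩

lemma HasPerfectCone.iso_comp_iso {X X' Y Y' : HtpyCat R} {f : X ⟶ Y} (hf : HasPerfectCone R f)
    (e : X' ≅ X) (e' : Y ≅ Y') : HasPerfectCone R (e.hom ≫ f ≫ e'.hom) := by
  obtain ⟨W, g, h, hW, hT⟩ := hf
  exact ⟨W, e'.inv ≫ g, h ≫ e.inv⟦1⟧', hW, isomorphic_distinguished _ hT _
    (Triangle.isoMk _ _ e e'.symm (Iso.refl _)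
      (by
        change (e.hom ≫ f ≫ e'.hom) ≫ e'.inv = e.hom ≫ f
        simp)
      (by
        change (e'.inv ≫ g) ≫ 𝟙 _ = e'.inv ≫ g
        simp)
      (by
        change (h ≫ e.inv⟦1⟧') ≫ e.hom⟦1⟧' = 𝟙 _ ≫ h
        rw [Category.assoc, ← Functor.map_comp, e.inv_hom_id, CategoryTheory.Functor.map_id]
        simp))⟩

/-- A degreewise epimorphism between complexes of finitely generated projectives whose kernel is
bounded has a perfect cone. -/
lemma hasPerfectCone_of_epi {P P' : CochainComplex (ModuleCat.{0} R) ℤ} (π : P ⟶ P')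
    (hP : ∀ i, Projective (P.X i) ∧ Module.Finite R (P.X i))
    (hP' : ∀ i, Projective (P'.X i)) (hπ : ∀ i, Epi (π.f i))
    (hbd : ∃ a b : ℤ, ∀ i, i < a ∨ b < i → Mono (π.f i)) :
    HasPerfectCone R ((HomotopyCategory.quotient _ (ComplexShape.up ℤ)).map π) := by
  have : Epi π := HomologicalComplex.epi_of_epi_f _ hπ
  let S : ShortComplex (CochainComplex (ModuleCat.{0} R) ℤ) :=
    ShortComplex.mk (kernel.ι π) π (kernel.condition π)
  have hS : S.ShortExact :=
    { exact := ShortComplex.exact_kernel π }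
  have hS' : ∀ i, (S.map (HomologicalComplex.eval _ (ComplexShape.up ℤ) i)).ShortExact :=
    fun i => hS.map_of_exact _
  let σ : ∀ i, (S.map (HomologicalComplex.eval _ (ComplexShape.up ℤ) i)).Splitting := fun i =>
    have : Projective ((S.map (HomologicalComplex.eval _ (ComplexShape.up ℤ) i)).X₃) := hP' i
    (hS' i).splittingOfProjective
  have hT : CochainComplex.trianglehOfDegreewiseSplit S σ ∈ distTriang (HtpyCat R) :=
    (HomotopyCategory.distinguished_iff_iso_trianglehOfDegreewiseSplit _).2
      ⟨S, σ, ⟨Iso.refl _⟩⟩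
  have hK : IsPerfObj R ((HomotopyCategory.quotient _ (ComplexShape.up ℤ)).obj (kernel π)) := by
    obtain ⟨a, b, hab⟩ := hbd
    refine ⟨kernel π, fun i => ⟨?_, ?_⟩, ⟨a, b, fun i hi => ?_⟩, ⟨Iso.refl _⟩⟩
    · have := (hP i).1
      exact (Retract.mk (Y := P.X i) _ _ (σ i).f_r).projective
    · have : Module.Finite R (S.map (HomologicalComplex.eval _ (ComplexShape.up ℤ) i)).X₂ :=
        (hP i).2
      refine Module.Finite.of_surjective (σ i).r.hom fun x => ⟨(S.f.f i).hom x, ?_⟩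
      exact ConcreteCategory.congr_hom (σ i).f_r x
    · have : Mono ((kernel.ι π).f i) := (hS' i).mono_f
      have : Mono (π.f i) := hab i hi
      exact IsZero.of_mono_eq_zero ((kernel.ι π).f i) (zero_of_comp_mono (π.f i)
        (S.map (HomologicalComplex.eval _ (ComplexShape.up ℤ) i)).zero)
  exact ⟨_, _, _, isPerfObj_shift hK 1, rot_of_distTriang _ hT⟩

attribute [local instance] HasDerivedCategory.standard

open DerivedCategory

/-- A right bounded complex of finitely generated projectives with bounded cohomology agrees, up
to perfect complexes, with a shift `Y⟦n⟧` of a resolution of a finitely generated module, for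
arbitrarily large `n`. -/
lemma IsDbObj.exists_hasPerfectCone [IsNoetherianRing R] {X : HtpyCat R} (hX : IsDbObj R X)
    (N : ℤ) : ∃ (n : ℤ) (_ : N ≤ n) (Z : ModuleCat.{0} R) (Y : HtpyCat R) (_ : Module.Finite R Z)
      (_ : IsResolution Y Z) (_ : IsDbObj R (Y⟦n⟧)) (f : X ⟶ Y⟦n⟧), HasPerfectCone R f := by
  obtain ⟨P, hP, ⟨b, hb⟩, ⟨a, ha⟩, ⟨e⟩⟩ := hX
  let m : ℤ := min (-N) (a - 1)
  obtain ⟨P', π, hP'm, hπ, hπm⟩ := exists_brutalTruncation P m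
  have hP' : ∀ i, Projective (P'.X i) ∧ Module.Finite R (P'.X i) := by
    intro i
    by_cases hi : i ≤ m
    · have := hπm i hi
      have := (hP i).1
      have := (hP i).2
      exact ⟨(Retract.mk (inv (π.f i)) (π.f i) (by simp)).projective,
        Module.Finite.equiv (asIso (π.f i)).toLinearEquiv⟩
    · refine ⟨(hP'm i (by lia)).projective, ?_⟩
      have := ModuleCat.subsingleton_of_isZero (hP'm i (by lia))
      infer_instance
  have hcone := hasPerfectCone_of_epi π hP (fun i => (hP' i).1) hπ
    ⟨m, b, fun i hi => by
      rcases hi with hi | hi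
      · have := hπm i hi.le
        infer_instance
      · exact ⟨fun _ _ _ => (hb i hi).eq_of_tgt _ _⟩⟩
  have hexact : ∀ i, i < m → P'.ExactAt i := by
    intro i hi
    have := hπm (i - 1) (by lia)
    have := hπm i (by lia)
    have := hπm (i + 1) (by lia)
    have h := ha i (by lia)
    rw [HomologicalComplex.exactAt_iff' _ (i - 1) i (i + 1) (by simp) (by simp)] at h ⊢
    let φ := (HomologicalComplex.shortComplexFunctor' (ModuleCat.{0} R) (ComplexShape.up ℤ)
      (i - 1) i (i + 1)).map π
    have : Epi φ.τ₁ := hπ (i - 1)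
    have : IsIso φ.τ₂ := hπm i (by lia)
    have : IsIso φ.τ₃ := hπm (i + 1) (by lia)
    exact (ShortComplex.exact_iff_of_epi_of_isIso_of_mono φ).1 h
  have : P'.IsStrictlyLE m := (P'.isStrictlyLE_iff m).2 hP'm
  have : P'.IsGE m := (P'.isGE_iff m).2 hexact
  have hP'db : IsDbObj R (ofComplex R P') := ⟨P', hP', ⟨m, hP'm⟩, ⟨m, hexact⟩, ⟨Iso.refl _⟩⟩
  obtain ⟨Z, ⟨eZ⟩⟩ := exists_iso_singleFunctor_obj_of_isGE_of_isLE (Q.obj P') m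
  have hZ : Module.Finite R Z := by
    have := (hP' m).2
    have : Module.Finite R (P'.cycles m) := Module.Finite.of_injective (P'.iCycles m).hom
      ((ModuleCat.mono_iff_injective _).1 inferInstance)
    have : Module.Finite R (P'.homology m) := Module.Finite.of_surjective (P'.homologyπ m).hom
      ((ModuleCat.epi_iff_surjective _).1 inferInstance)
    have : Module.Finite R
        ((HomologicalComplex.homologyFunctor (ModuleCat.{0} R) (ComplexShape.up ℤ) m).obj P') := this
    exact Module.Finite.equiv (((homologyFunctorFactors (ModuleCat.{0} R) m).app P').symm ≪≫
      (homologyFunctor (ModuleCat.{0} R) m).mapIso eZ ≪≫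
      (singleFunctorCompHomologyFunctorIso (ModuleCat.{0} R) m).app Z).toLinearEquiv
  obtain ⟨Y, hY⟩ := exists_isResolution Z
  obtain ⟨eY⟩ := hY.nonempty_iso
  have hYdb : (HomotopyCategory.subcategoryAcyclic (ModuleCat.{0} R)).leftOrthogonal (Y⟦-m⟧) :=
    ObjectProperty.le_shift _ _ _ hY.isDbObj.leftOrthogonal
  let e₁ : Qh.obj (ofComplex R P') ≅ Qh.obj (Y⟦-m⟧) :=
    (quotientCompQhIso (ModuleCat.{0} R)).app P' ≪≫ eZ ≪≫
      (((singleFunctors (ModuleCat.{0} R)).shiftIso (-m) m 0 (by simp)).app Z).symm ≪≫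
      (shiftFunctor _ (-m)).mapIso eY.symm ≪≫ ((Qh.commShiftIso (-m)).app Y).symm
  obtain ⟨e', -⟩ := exists_iso_of_Qh_iso hP'db.leftOrthogonal hYdb e₁
  exact ⟨-m, by lia, Z, Y, hZ, hY, hP'db.of_iso e'.symm, _, hcone.iso_comp_iso e e'⟩

end Truncation

/-! ### Vanishing on modules of finite length. -/

section FiniteLength

variable {R : Type} [Ring R]

/-- A simple module over an Artinian ring is a direct summand of the semisimple quotient of the
ring by its radical. -/
lemma exists_retract_quotient_jacobson [IsArtinianRing R] (T : ModuleCat.{0} R)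
    [IsSimpleModule R T] :
    ∃ (i : T ⟶ ModuleCat.of R (R ⧸ Module.jacobson R R))
      (r : ModuleCat.of R (R ⧸ Module.jacobson R R) ⟶ T), i ≫ r = 𝟙 T := by
  obtain ⟨I, hI, ⟨e⟩⟩ := isSimpleModule_iff_quot_maximal.1 ‹IsSimpleModule R T›
  have : IsSemisimpleModule R (R ⧸ Module.jacobson R R) :=
    (IsArtinian.isSemisimpleModule_iff_jacobson R _).2 (Module.jacobson_quotient_jacobson R R)
  let r : (R ⧸ Module.jacobson R R) →ₗ[R] T :=
    e.symm.toLinearMap ∘ₗ Submodule.factor (sInf_le hI.out : Module.jacobson R R ≤ I)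
  have hr : Function.Surjective r :=
    e.symm.surjective.comp (Submodule.factor_surjective _)
  obtain ⟨i, hi⟩ := IsSemisimpleModule.lifting_property r hr LinearMap.id
  exact ⟨ModuleCat.ofHom i, ModuleCat.ofHom r, ModuleCat.hom_ext hi⟩

variable {C : Type u} [Category.{v} C] [Preadditive C] [HasZeroObject C] [HasShift C ℤ]
  [∀ n : ℤ, (shiftFunctor C n).Additive] [Pretriangulated C]

lemma HomShiftVanishes.of_isResolution_retract (D : SgModelData R C) {A : C} {n : ℤ}
    {Z Z' : ModuleCat.{0} R} (i : Z' ⟶ Z) (r : Z ⟶ Z') (hir : i ≫ r = 𝟙 Z') {Y Y' : HtpyCat R}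
    (hY : IsResolution Y Z) (hY' : IsResolution Y' Z')
    (h : HomShiftVanishes A (D.Q.obj ⟨Y, hY.isDbObj⟩) n) :
    HomShiftVanishes A (D.Q.obj ⟨Y', hY'.isDbObj⟩) n := by
  obtain ⟨i', r', hir'⟩ := exists_retract_of_retract i r hir hY hY'
  refine h.retract_right
    (D.Q.map (X := ⟨Y', hY'.isDbObj⟩) (Y := ⟨Y, hY.isDbObj⟩) (ObjectProperty.homMk i'))
    (D.Q.map (X := ⟨Y, hY.isDbObj⟩) (Y := ⟨Y', hY'.isDbObj⟩) (ObjectProperty.homMk r')) ?_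
  rw [← Functor.map_comp, ← CategoryTheory.Functor.map_id]
  exact congrArg _ (ObjectProperty.hom_ext _ hir')

lemma HomShiftVanishes.of_isFiniteLength [IsArtinianRing R] (D : SgModelData R C)
    {A : C} {n : ℤ} {Y : HtpyCat R}
    (hY : IsResolution Y (ModuleCat.of R (R ⧸ Module.jacobson R R)))
    (h : HomShiftVanishes A (D.Q.obj ⟨Y, hY.isDbObj⟩) n) (Z : Type) [AddCommGroup Z] [Module R Z]
    (hZ : IsFiniteLength R Z) (Y' : HtpyCat R) (hY' : IsResolution Y' (ModuleCat.of R Z)) :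
    HomShiftVanishes A (D.Q.obj ⟨Y', hY'.isDbObj⟩) n := by
  induction hZ generalizing Y' with
  | @of_subsingleton M _ _ _ =>
    exact h.of_isResolution_retract D 0 0
      ((ModuleCat.isZero_of_subsingleton (ModuleCat.of R M)).eq_of_src _ _) hY hY'
  | @of_simple_quotient M _ _ N _ hN ih =>
    have := (isFiniteLength_iff_isNoetherian_isArtinian.1 hN).1
    obtain ⟨Y₁, hY₁⟩ := exists_isResolution (ModuleCat.of R N)
    obtain ⟨Y₃, hY₃⟩ := exists_isResolution (ModuleCat.of R (M ⧸ N))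
    let S : ShortComplex (ModuleCat.{0} R) := ShortComplex.mk
      (ModuleCat.ofHom N.subtype) (ModuleCat.ofHom N.mkQ) (by ext; simp)
    have hS : S.ShortExact := ModuleCat.shortComplex_shortExact S
      (LinearMap.exact_subtype_mkQ N) N.subtype_injective N.mkQ_surjective
    obtain ⟨f, g, k, hT⟩ := exists_distTriang_of_shortExact hS hY₁ hY' hY₃
    obtain ⟨k', hT'⟩ := D.mapsTriangles ⟨Y₁, hY₁.isDbObj⟩ ⟨Y', hY'.isDbObj⟩ ⟨Y₃, hY₃.isDbObj⟩
      f g k hT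
    have : IsSimpleModule R (ModuleCat.of R (M ⧸ N)) := ‹_›
    obtain ⟨i, r, hir⟩ := exists_retract_quotient_jacobson (ModuleCat.of R (M ⧸ N))
    exact of_distTriang_right hT' (ih Y₁ hY₁) (h.of_isResolution_retract D i r hir hY hY₃)

/-- Over an Artinian ring, the singularity category has no non-zero silting object. -/
theorem IsSiltingObj.isZero_of_sgModelData [IsArtinianRing R] (D : SgModelData R C) {M : C}
    (hM : IsSiltingObj M) : IsZero M := by
  obtain ⟨X, ⟨e⟩⟩ := D.essSurj M
  obtain ⟨Y, hY⟩ := exists_isResolution (ModuleCat.of R (R ⧸ Module.jacobson R R))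
  obtain ⟨N, hN⟩ := hM.eventually_homShiftVanishes (D.Q.obj X) (D.Q.obj ⟨Y, hY.isDbObj⟩)
  obtain ⟨n, hn, Z, Y', hZ, hY', hY'n, f, hf⟩ := X.property.exists_hasPerfectCone N
  have hlen : IsFiniteLength R Z := isFiniteLength_iff_isNoetherian_isArtinian.2
    ⟨inferInstance, inferInstance⟩
  have h := HomShiftVanishes.of_isFiniteLength D hY (hN n hn) Z hlen Y' hY'
  have := (D.invertsIff X ⟨Y'⟦n⟧, hY'n⟩ f).2 hf
  obtain ⟨e'⟩ := D.commShift ⟨Y', hY'.isDbObj⟩ n hY'n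
  let e'' := asIso (D.Q.map (X := X) (Y := ⟨Y'⟦n⟧, hY'n⟩) (ObjectProperty.homMk f)) ≪≫ e'
  refine IsZero.of_iso ((IsZero.iff_id_eq_zero _).2 ?_) e.symm
  rw [← cancel_mono e''.hom, h (𝟙 _ ≫ e''.hom), zero_comp]

end FiniteLength

/-- Theorem 2.2 of the paper.  Let `Λ` be a finite-dimensional
algebra over an algebraically closed field `K` whose regular right module has
finite injective dimension.  Then the singularity category `D_sg(Λ)` (any model
of the Verdier quotient of `D^b(mod Λ)` by `K^b(proj Λ)`) admits no non-zero
silting object. -/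
theorem singularity_category_has_no_nonzero_silting
    (K Λ : Type) [Field K] [IsAlgClosed K] [Ring Λ] [Algebra K Λ] [FiniteDimensional K Λ]
    (hinj : HasFiniteSelfInjDim Λᵐᵒᵖ) :
    ∀ (C : Type u) [Category.{v} C] [Preadditive C] [HasZeroObject C] [HasShift C ℤ]
      [∀ n : ℤ, (shiftFunctor C n).Additive] [Pretriangulated C],
      SgModelData Λᵐᵒᵖ C → ∀ M : C, IsSiltingObj M → IsZero M := by
  intro C _ _ _ _ _ _ D M hM
  have : IsArtinianRing Λᵐᵒᵖ := IsArtinianRing.of_finite K Λᵐᵒᵖ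
  exact hM.isZero_of_sgModelData D

end PaperSilting
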